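/- arXiv:2206.11594 — 2 statements merged into one kernel-verified Lean document; each statement's English description precedes it below -/
import Mathlib

section
/- Let g be an isometry of order 2 of the lattice 𝐋 = 3U ⊕ 2E8 ⊕ A2, and let n denote the rank of the coinvariant sublattice 𝐋_g. Then the absolute value of the determinant of the bilinear form restricted to 𝐋_g satisfies |det(𝐋_g)| ≤ 3 · 2^{min(n, 24-n)}. -/
open Matrix

/-- Gram matrix of the lattice `𝐋 = 3U ⊕ 2E8 ⊕ A2` (with `E8` negative definite):
three hyperbolic blocks, two copies of the negative definite `E8` Gram matrix,
and the `A2` block `!![-2,1;1,-2]`. -/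
def LGram : Matrix (Fin 24) (Fin 24) ℤ :=
  !![0, 1, 0, 0, 0, 0, 0, 0, 0, 0, 0, 0, 0, 0, 0, 0, 0, 0, 0, 0, 0, 0, 0, 0;
    1, 0, 0, 0, 0, 0, 0, 0, 0, 0, 0, 0, 0, 0, 0, 0, 0, 0, 0, 0, 0, 0, 0, 0;
    0, 0, 0, 1, 0, 0, 0, 0, 0, 0, 0, 0, 0, 0, 0, 0, 0, 0, 0, 0, 0, 0, 0, 0;
    0, 0, 1, 0, 0, 0, 0, 0, 0, 0, 0, 0, 0, 0, 0, 0, 0, 0, 0, 0, 0, 0, 0, 0;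
    0, 0, 0, 0, 0, 1, 0, 0, 0, 0, 0, 0, 0, 0, 0, 0, 0, 0, 0, 0, 0, 0, 0, 0;
    0, 0, 0, 0, 1, 0, 0, 0, 0, 0, 0, 0, 0, 0, 0, 0, 0, 0, 0, 0, 0, 0, 0, 0;
    0, 0, 0, 0, 0, 0, -2, 0, 1, 0, 0, 0, 0, 0, 0, 0, 0, 0, 0, 0, 0, 0, 0, 0;
    0, 0, 0, 0, 0, 0, 0, -2, 0, 1, 0, 0, 0, 0, 0, 0, 0, 0, 0, 0, 0, 0, 0, 0;
    0, 0, 0, 0, 0, 0, 1, 0, -2, 1, 0, 0, 0, 0, 0, 0, 0, 0, 0, 0, 0, 0, 0, 0;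
    0, 0, 0, 0, 0, 0, 0, 1, 1, -2, 1, 0, 0, 0, 0, 0, 0, 0, 0, 0, 0, 0, 0, 0;
    0, 0, 0, 0, 0, 0, 0, 0, 0, 1, -2, 1, 0, 0, 0, 0, 0, 0, 0, 0, 0, 0, 0, 0;
    0, 0, 0, 0, 0, 0, 0, 0, 0, 0, 1, -2, 1, 0, 0, 0, 0, 0, 0, 0, 0, 0, 0, 0;
    0, 0, 0, 0, 0, 0, 0, 0, 0, 0, 0, 1, -2, 1, 0, 0, 0, 0, 0, 0, 0, 0, 0, 0;
    0, 0, 0, 0, 0, 0, 0, 0, 0, 0, 0, 0, 1, -2, 0, 0, 0, 0, 0, 0, 0, 0, 0, 0;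
    0, 0, 0, 0, 0, 0, 0, 0, 0, 0, 0, 0, 0, 0, -2, 0, 1, 0, 0, 0, 0, 0, 0, 0;
    0, 0, 0, 0, 0, 0, 0, 0, 0, 0, 0, 0, 0, 0, 0, -2, 0, 1, 0, 0, 0, 0, 0, 0;
    0, 0, 0, 0, 0, 0, 0, 0, 0, 0, 0, 0, 0, 0, 1, 0, -2, 1, 0, 0, 0, 0, 0, 0;
    0, 0, 0, 0, 0, 0, 0, 0, 0, 0, 0, 0, 0, 0, 0, 1, 1, -2, 1, 0, 0, 0, 0, 0;
    0, 0, 0, 0, 0, 0, 0, 0, 0, 0, 0, 0, 0, 0, 0, 0, 0, 1, -2, 1, 0, 0, 0, 0;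
    0, 0, 0, 0, 0, 0, 0, 0, 0, 0, 0, 0, 0, 0, 0, 0, 0, 0, 1, -2, 1, 0, 0, 0;
    0, 0, 0, 0, 0, 0, 0, 0, 0, 0, 0, 0, 0, 0, 0, 0, 0, 0, 0, 1, -2, 1, 0, 0;
    0, 0, 0, 0, 0, 0, 0, 0, 0, 0, 0, 0, 0, 0, 0, 0, 0, 0, 0, 0, 1, -2, 0, 0;
    0, 0, 0, 0, 0, 0, 0, 0, 0, 0, 0, 0, 0, 0, 0, 0, 0, 0, 0, 0, 0, 0, -2, 1;
    0, 0, 0, 0, 0, 0, 0, 0, 0, 0, 0, 0, 0, 0, 0, 0, 0, 0, 0, 0, 0, 0, 1, -2]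

/-- The bilinear form of the lattice `𝐋`. -/
def Bf (v w : Fin 24 → ℤ) : ℤ := v ⬝ᵥ (LGram *ᵥ w)

/-- An isometry of `𝐋` is a `ℤ`-linear automorphism preserving the bilinear form. -/
def IsIsometry (g : (Fin 24 → ℤ) ≃ₗ[ℤ] (Fin 24 → ℤ)) : Prop :=
  ∀ v w, Bf (g v) (g w) = Bf v w

/-- The invariant sublattice `𝐋^g = {v ∈ 𝐋 : g v = v}`. -/
def invL (g : (Fin 24 → ℤ) ≃ₗ[ℤ] (Fin 24 → ℤ)) : Submodule ℤ (Fin 24 → ℤ) where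
  carrier := {v | g v = v}
  add_mem' := by intro a b ha hb; simp only [Set.mem_setOf_eq, map_add] at *; rw [ha, hb]
  zero_mem' := by simp
  smul_mem' := by intro c a ha; simp only [Set.mem_setOf_eq, _root_.map_smul] at *; rw [ha]

/-- The coinvariant sublattice `𝐋_g = {v ∈ 𝐋 : v·w = 0 for all w ∈ 𝐋^g}`. -/
def coinvL (g : (Fin 24 → ℤ) ≃ₗ[ℤ] (Fin 24 → ℤ)) : Submodule ℤ (Fin 24 → ℤ) where
  carrier := {v | ∀ w ∈ invL g, Bf v w = 0}
  add_mem' := by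
    intro a b ha hb w hw
    simp only [Bf, add_dotProduct] at *
    rw [ha w hw, hb w hw, add_zero]
  zero_mem' := by intro w hw; simp [Bf]
  smul_mem' := by
    intro c a ha w hw
    simp only [Bf, smul_dotProduct] at *
    rw [ha w hw, smul_zero]

/-- The divisibility of `v` in `𝐋` is `d`, i.e. `gcd {v·w : w ∈ 𝐋} = d`. -/
def HasDivisibility (v : Fin 24 → ℤ) (d : ℤ) : Prop :=
  (∀ w, d ∣ Bf v w) ∧ ∀ e : ℤ, (∀ w, e ∣ Bf v w) → e ∣ d

/-- The determinant of a Gram matrix of the bilinear form of `𝐋` restricted to a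
sublattice `M ⊆ 𝐋` (computed in a choice of basis of `M`; it is independent of this
choice since base change matrices over `ℤ` have determinant `±1`). -/
noncomputable def gramDet (M : Submodule ℤ (Fin 24 → ℤ)) : ℤ :=
  letI b := Module.Free.chooseBasis ℤ M
  letI : DecidableEq (Module.Free.ChooseBasisIndex ℤ M) := Classical.decEq _
  Matrix.det (Matrix.of fun i j => Bf (b i) (b j))

/-- An integral matrix such that `LGram * LAux` is lower triangular with determinant `-3`. -/
def LAux : Matrix (Fin 24) (Fin 24) ℤ :=
  !![0, 1, 0, 0, 0, 0, 0, 0, 0, 0, 0, 0, 0, 0, 0, 0, 0, 0, 0, 0, 0, 0, 0, 0;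
    1, 0, 0, 0, 0, 0, 0, 0, 0, 0, 0, 0, 0, 0, 0, 0, 0, 0, 0, 0, 0, 0, 0, 0;
    0, 0, 0, 1, 0, 0, 0, 0, 0, 0, 0, 0, 0, 0, 0, 0, 0, 0, 0, 0, 0, 0, 0, 0;
    0, 0, 1, 0, 0, 0, 0, 0, 0, 0, 0, 0, 0, 0, 0, 0, 0, 0, 0, 0, 0, 0, 0, 0;
    0, 0, 0, 0, 0, 1, 0, 0, 0, 0, 0, 0, 0, 0, 0, 0, 0, 0, 0, 0, 0, 0, 0, 0;
    0, 0, 0, 0, 1, 0, 0, 0, 0, 0, 0, 0, 0, 0, 0, 0, 0, 0, 0, 0, 0, 0, 0, 0;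
    0, 0, 0, 0, 0, 0, -4, -5, -7, -10, -8, -6, -4, -2, 0, 0, 0, 0, 0, 0, 0, 0, 0, 0;
    0, 0, 0, 0, 0, 0, -5, -8, -10, -15, -12, -9, -6, -3, 0, 0, 0, 0, 0, 0, 0, 0, 0, 0;
    0, 0, 0, 0, 0, 0, -7, -10, -14, -20, -16, -12, -8, -4, 0, 0, 0, 0, 0, 0, 0, 0, 0, 0;
    0, 0, 0, 0, 0, 0, -10, -15, -20, -30, -24, -18, -12, -6, 0, 0, 0, 0, 0, 0, 0, 0, 0, 0;
    0, 0, 0, 0, 0, 0, -8, -12, -16, -24, -20, -15, -10, -5, 0, 0, 0, 0, 0, 0, 0, 0, 0, 0;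
    0, 0, 0, 0, 0, 0, -6, -9, -12, -18, -15, -12, -8, -4, 0, 0, 0, 0, 0, 0, 0, 0, 0, 0;
    0, 0, 0, 0, 0, 0, -4, -6, -8, -12, -10, -8, -6, -3, 0, 0, 0, 0, 0, 0, 0, 0, 0, 0;
    0, 0, 0, 0, 0, 0, -2, -3, -4, -6, -5, -4, -3, -2, 0, 0, 0, 0, 0, 0, 0, 0, 0, 0;
    0, 0, 0, 0, 0, 0, 0, 0, 0, 0, 0, 0, 0, 0, -4, -5, -7, -10, -8, -6, -4, -2, 0, 0;
    0, 0, 0, 0, 0, 0, 0, 0, 0, 0, 0, 0, 0, 0, -5, -8, -10, -15, -12, -9, -6, -3, 0, 0;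
    0, 0, 0, 0, 0, 0, 0, 0, 0, 0, 0, 0, 0, 0, -7, -10, -14, -20, -16, -12, -8, -4, 0, 0;
    0, 0, 0, 0, 0, 0, 0, 0, 0, 0, 0, 0, 0, 0, -10, -15, -20, -30, -24, -18, -12, -6, 0, 0;
    0, 0, 0, 0, 0, 0, 0, 0, 0, 0, 0, 0, 0, 0, -8, -12, -16, -24, -20, -15, -10, -5, 0, 0;
    0, 0, 0, 0, 0, 0, 0, 0, 0, 0, 0, 0, 0, 0, -6, -9, -12, -18, -15, -12, -8, -4, 0, 0;
    0, 0, 0, 0, 0, 0, 0, 0, 0, 0, 0, 0, 0, 0, -4, -6, -8, -12, -10, -8, -6, -3, 0, 0;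
    0, 0, 0, 0, 0, 0, 0, 0, 0, 0, 0, 0, 0, 0, -2, -3, -4, -6, -5, -4, -3, -2, 0, 0;
    0, 0, 0, 0, 0, 0, 0, 0, 0, 0, 0, 0, 0, 0, 0, 0, 0, 0, 0, 0, 0, 0, 0, 1;
    0, 0, 0, 0, 0, 0, 0, 0, 0, 0, 0, 0, 0, 0, 0, 0, 0, 0, 0, 0, 0, 0, 1, 2]

theorem LGram_mul_LAux_lower : ∀ i j : Fin 24, i < j → (LGram * LAux) i j = 0 := by
  decide +kernel

theorem LGram_mul_LAux_diag : ∏ i : Fin 24, (LGram * LAux) i i = -3 := by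
  decide +kernel

theorem LGram_symm : LGramᵀ = LGram := by
  decide +kernel

theorem LGram_det_dvd : LGram.det ∣ 3 := by
  have h : (LGram * LAux).det = -3 := by
    rw [Matrix.det_of_isLowerTriangular, LGram_mul_LAux_diag]
    intro i j hij
    exact LGram_mul_LAux_lower i j (by simpa using hij)
  rw [Matrix.det_mul] at h
  exact (Dvd.intro _ h).trans (by norm_num)

theorem Bf_add_left (u v w : Fin 24 → ℤ) : Bf (u + v) w = Bf u w + Bf v w := by
  simp [Bf, add_dotProduct]

theorem Bf_smul_left (c : ℤ) (v w : Fin 24 → ℤ) : Bf (c • v) w = c * Bf v w := by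
  rw [Bf, smul_dotProduct, smul_eq_mul, Bf]

theorem Bf_comm (v w : Fin 24 → ℤ) : Bf v w = Bf w v := by
  unfold Bf
  rw [Matrix.dotProduct_mulVec, dotProduct_comm, ← Matrix.mulVec_transpose, LGram_symm]

/-- The form as a bilinear map. -/
def BfLin (w : Fin 24 → ℤ) : (Fin 24 → ℤ) →ₗ[ℤ] ℤ where
  toFun v := Bf v w
  map_add' u v := Bf_add_left u v w
  map_smul' c v := by rw [Bf_smul_left]; rfl

theorem BfLin_apply (v w : Fin 24 → ℤ) : BfLin w v = Bf v w := rfl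

/-- The Gram determinant in any basis of `𝐋` divides `3`. -/
theorem gram_basis_dvd {ι : Type*} [Fintype ι] [DecidableEq ι]
    (β : Module.Basis ι ℤ (Fin 24 → ℤ)) :
    (Matrix.of fun i j => Bf (β i) (β j)).det ∣ 3 := by
  let e : ι ≃ Fin 24 := β.indexEquiv (Pi.basisFun ℤ (Fin 24))
  let β' := β.reindex e
  let T : Matrix (Fin 24) (Fin 24) ℤ := (Pi.basisFun ℤ (Fin 24)).toMatrix β'
  have hT : IsUnit T.det := by
    have h := congrArg Matrix.det ((Pi.basisFun ℤ (Fin 24)).toMatrix_mul_toMatrix_flip β')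
    rw [Matrix.det_mul, Matrix.det_one] at h
    exact IsUnit.of_mul_eq_one _ h
  have h1 : (Matrix.of fun i j => Bf (β i) (β j)) = (Tᵀ * LGram * T).submatrix e e := by
    ext i j
    simp only [Matrix.of_apply, Matrix.submatrix_apply, Bf]
    rw [Matrix.mul_assoc, Matrix.mul_apply]
    simp [dotProduct, Matrix.mulVec, T, β', Matrix.mul_apply, Module.Basis.toMatrix_apply]
  rw [h1, Matrix.det_submatrix_equiv_self, Matrix.det_mul, Matrix.det_mul, Matrix.det_transpose]
  exact (hT.mul_right_dvd).2 ((hT.mul_left_dvd).2 LGram_det_dvd)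

theorem sub_mem_coinvL {g : (Fin 24 → ℤ) ≃ₗ[ℤ] (Fin 24 → ℤ)} (hiso : IsIsometry g)
    (c : Fin 24 → ℤ) : c - g c ∈ coinvL g := by
  intro w hw
  have hw' : g w = w := hw
  have h := hiso c w
  rw [hw'] at h
  rw [← BfLin_apply, map_sub, BfLin_apply, BfLin_apply, h, sub_self]

theorem add_mem_invL {g : (Fin 24 → ℤ) ≃ₗ[ℤ] (Fin 24 → ℤ)} (hgg : ∀ v, g (g v) = v)
    (c : Fin 24 → ℤ) : c + g c ∈ invL g := by
  change g (c + g c) = c + g c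
  rw [map_add, hgg, add_comm]

theorem quot_torsionFree (g : (Fin 24 → ℤ) ≃ₗ[ℤ] (Fin 24 → ℤ)) :
    Module.IsTorsionFree ℤ ((Fin 24 → ℤ) ⧸ coinvL g) := by
  rw [Module.isTorsionFree_iff_smul_eq_zero]
  intro c x hx
  obtain ⟨v, rfl⟩ := Submodule.Quotient.mk_surjective _ x
  by_cases hc : c = 0
  · exact Or.inl hc
  right
  rw [← Submodule.Quotient.mk_smul, Submodule.Quotient.mk_eq_zero] at hx
  rw [Submodule.Quotient.mk_eq_zero]
  intro w hw
  have := hx w hw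
  rw [Bf_smul_left] at this
  exact (mul_eq_zero.1 this).resolve_left hc

/-- If `g` is an isometry of order `2` of `𝐋 = 3U ⊕ 2E8 ⊕ A2` and `n` is the rank of the
coinvariant sublattice `𝐋_g`, then `|det(𝐋_g)| ≤ 3 · 2^(min(n, 24-n))`. -/
theorem stmt4 (g : (Fin 24 → ℤ) ≃ₗ[ℤ] (Fin 24 → ℤ)) (hiso : IsIsometry g)
    (hord : orderOf g = 2) :
    (gramDet (coinvL g)).natAbs ≤
      3 * 2 ^ min (Module.finrank ℤ (coinvL g)) (24 - Module.finrank ℤ (coinvL g)) := by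
  classical
  have hgg : ∀ v, g (g v) = v := by
    intro v
    have h : g ^ 2 = 1 := by rw [← hord]; exact pow_orderOf_eq_one g
    rw [pow_two] at h
    exact congrArg (fun f => f v) h
  have := quot_torsionFree g
  set ι := Module.Free.ChooseBasisIndex ℤ (coinvL g) with hι
  let b : Module.Basis ι ℤ (coinvL g) := Module.Free.chooseBasis ℤ (coinvL g)
  let κ := Module.Free.ChooseBasisIndex ℤ ((Fin 24 → ℤ) ⧸ coinvL g)
  let q : Module.Basis κ ℤ ((Fin 24 → ℤ) ⧸ coinvL g) := Module.Free.chooseBasis ℤ _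
  let β : Module.Basis (ι ⊕ κ) ℤ (Fin 24 → ℤ) := Module.Basis.sumQuot b q
  let c : κ → (Fin 24 → ℤ) := fun j => β (Sum.inr j)
  have hβ : ∀ i, β (Sum.inl i) = b i := fun i => Module.Basis.sumQuot_inl b q i
  let A : Matrix ι ι ℤ := Matrix.of fun i j => Bf (b i) (b j)
  have hA : gramDet (coinvL g) = A.det := by
    unfold gramDet
    simp only [A, b]
    congr!
  have hn : Module.finrank ℤ (coinvL g) = Fintype.card ι := Module.finrank_eq_card_basis b
  have hk : 24 - Fintype.card ι = Fintype.card κ := by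
    have h := Module.finrank_eq_card_basis β
    rw [Module.finrank_fin_fun, Fintype.card_sum] at h
    omega
  let B : Matrix ι κ ℤ := Matrix.of fun i j => Bf (b i) (c j)
  let D : Matrix κ κ ℤ := Matrix.of fun i j => Bf (c i) (c j)
  let P : Matrix ι κ ℤ := Matrix.of fun i j => b.repr ⟨c j - g (c j), sub_mem_coinvL hiso (c j)⟩ i
  have hP : ∀ j, c j - g (c j) = ∑ i, P i j • (b i : Fin 24 → ℤ) := by
    intro j
    have h := congrArg (Subtype.val) (b.sum_repr ⟨c j - g (c j), sub_mem_coinvL hiso (c j)⟩)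
    simp only [Submodule.coe_sum, Submodule.coe_smul] at h
    exact h.symm
  have hG : (Matrix.of fun i j => Bf (β i) (β j)) = Matrix.fromBlocks A B Bᵀ D := by
    ext i j
    rcases i with i | i <;> rcases j with j | j <;>
      simp [A, B, D, hβ, c]
    exact Bf_comm _ _
  have hdet : (Matrix.fromBlocks A B Bᵀ D).det ∣ 3 := hG ▸ gram_basis_dvd β
  have hAP : A * P = (2 : ℤ) • B := by
    ext i j
    have h0 : Bf (b i) (c j + g (c j)) = 0 := (b i).2 _ (add_mem_invL hgg (c j))
    have h1 : Bf (c j - g (c j)) (b i) = ∑ l, P l j * Bf (b l) (b i) := by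
      rw [hP, ← BfLin_apply, map_sum]
      refine Finset.sum_congr rfl fun l _ => ?_
      rw [BfLin_apply, Bf_smul_left]
    rw [Bf_comm, ← BfLin_apply, map_add, BfLin_apply, BfLin_apply] at h0
    rw [← BfLin_apply, map_sub, BfLin_apply, BfLin_apply] at h1
    have h2 : (A * P) i j = ∑ l, P l j * Bf (b l) (b i) := by
      rw [Matrix.mul_apply]
      refine Finset.sum_congr rfl fun l _ => ?_
      rw [mul_comm, Bf_comm]
      rfl
    rw [h2, ← h1]
    simp only [B, Matrix.smul_apply, Matrix.of_apply, Bf_comm (b i : Fin 24 → ℤ) (c j)]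
    simp
    linarith
  have hAt : Aᵀ = A := by
    ext i j
    exact Bf_comm _ _
  -- first bound
  have hd1 : A.det ∣ 3 * 2 ^ Fintype.card ι := by
    have h : Matrix.fromBlocks ((2 : ℤ) • (1 : Matrix ι ι ℤ)) 0 0 1 * Matrix.fromBlocks A B Bᵀ D
        = Matrix.fromBlocks A 0 0 1 * Matrix.fromBlocks ((2 : ℤ) • (1 : Matrix ι ι ℤ)) P Bᵀ D := by
      simp only [Matrix.fromBlocks_multiply]
      simp only [hAP, smul_zero, Matrix.smul_mul, Matrix.mul_smul, Matrix.one_mul, Matrix.mul_one, Matrix.zero_mul, Matrix.mul_zero, add_zero,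
        zero_add, Matrix.neg_mul, neg_add_cancel]
    have h' := congrArg Matrix.det h
    rw [Matrix.det_mul, Matrix.det_mul, Matrix.det_fromBlocks_zero₂₁,
      Matrix.det_fromBlocks_zero₂₁, Matrix.det_smul, Matrix.det_one, Matrix.det_one,
      mul_one, mul_one, mul_one] at h'
    rw [mul_comm 3]
    exact (Dvd.intro _ h'.symm).trans (mul_dvd_mul_left _ hdet)
  have hd2 : A.det ∣ 3 * 2 ^ Fintype.card κ := by
    have h : Matrix.fromBlocks (1 : Matrix ι ι ℤ) 0 (-Pᵀ) ((2 : ℤ) • (1 : Matrix κ κ ℤ)) *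
        Matrix.fromBlocks A B Bᵀ D
        = Matrix.fromBlocks A B 0 (-Pᵀ * B + (2 : ℤ) • D) := by
      have h3 : Pᵀ * A = (2 : ℤ) • Bᵀ := by
        have := congrArg Matrix.transpose hAP
        rwa [Matrix.transpose_mul, hAt, Matrix.transpose_smul] at this
      simp only [Matrix.fromBlocks_multiply]
      simp only [h3, Matrix.smul_mul, Matrix.mul_smul, Matrix.one_mul, Matrix.mul_one, Matrix.zero_mul, Matrix.mul_zero, add_zero,
        zero_add, Matrix.neg_mul, neg_add_cancel]
    have h' := congrArg Matrix.det h
    rw [Matrix.det_mul, Matrix.det_fromBlocks_zero₂₁,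
      Matrix.det_fromBlocks_zero₁₂, Matrix.det_smul, Matrix.det_one, Matrix.det_one,
      mul_one, one_mul] at h'
    rw [mul_comm 3]
    exact (Dvd.intro _ h'.symm).trans (mul_dvd_mul_left _ hdet)
  have key : ∀ m : ℕ, A.det ∣ 3 * 2 ^ m → A.det.natAbs ≤ 3 * 2 ^ m := by
    intro m hm
    have h := Int.natAbs_dvd_natAbs.2 hm
    rw [Int.natAbs_mul, Int.natAbs_pow] at h
    exact Nat.le_of_dvd (by positivity) h
  rw [hA, hn, hk]
  rcases min_choice (Fintype.card ι) (Fintype.card κ) with h | h <;> rw [h]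
  · exact key _ hd1
  · exact key _ hd2
end

section
/- Let T be an even negative definite lattice of rank n with 2 ≤ n ≤ 21, containing no vector of square -2 and no vector of square -4. Then the absolute value of the determinant of T satisfies |det(T)| > 3 · 2^{min(n, 24-n)}. -/
open Matrix

/- A lattice of rank `m` is modelled, via a choice of basis, as `ℤ^m = Fin m → ℤ`
equipped with the non-degenerate symmetric bilinear form given by a Gram matrix `S`. -/

variable {m : ℕ}

/-- The bilinear form associated with the Gram matrix `S`. -/
def BM (S : Matrix (Fin m) (Fin m) ℤ) (v w : Fin m → ℤ) : ℤ := v ⬝ᵥ (S *ᵥ w)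

/-- The invariant sublattice `L^g = {v ∈ L : g v = v}` of an automorphism `g`. -/
def invM (g : (Fin m → ℤ) ≃ₗ[ℤ] (Fin m → ℤ)) : Submodule ℤ (Fin m → ℤ) where
  carrier := {v | g v = v}
  add_mem' := by intro a b ha hb; simp only [Set.mem_setOf_eq, map_add] at *; rw [ha, hb]
  zero_mem' := by simp
  smul_mem' := by intro c a ha; simp only [Set.mem_setOf_eq, _root_.map_smul] at *; rw [ha]

/-- The orthogonal complement `M^⊥ = {v ∈ L : v·w = 0 for all w ∈ M}` of a sublattice. -/
def orthoM (S : Matrix (Fin m) (Fin m) ℤ) (M : Submodule ℤ (Fin m → ℤ)) :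
    Submodule ℤ (Fin m → ℤ) where
  carrier := {v | ∀ w ∈ M, BM S v w = 0}
  add_mem' := by
    intro a b ha hb w hw
    simp only [BM, add_dotProduct] at *
    rw [ha w hw, hb w hw, add_zero]
  zero_mem' := by intro w hw; simp [BM]
  smul_mem' := by
    intro c a ha w hw
    simp only [BM, smul_dotProduct] at *
    rw [ha w hw, smul_zero]

/-- The coinvariant sublattice `L_g = (L^g)^⊥`. -/
def coinvM (S : Matrix (Fin m) (Fin m) ℤ) (g : (Fin m → ℤ) ≃ₗ[ℤ] (Fin m → ℤ)) :
    Submodule ℤ (Fin m → ℤ) :=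
  orthoM S (invM g)

/-- `g` is an isometry with respect to the Gram matrix `S`. -/
def IsIsomM (S : Matrix (Fin m) (Fin m) ℤ) (g : (Fin m → ℤ) ≃ₗ[ℤ] (Fin m → ℤ)) : Prop :=
  ∀ v w, BM S (g v) (g w) = BM S v w


open MeasureTheory in
lemma blich_pack {E ι : Type*} [NormedAddCommGroup E] [InnerProductSpace ℝ E] [DecidableEq ι] (s : Finset ι)
    (a : ι → E) (h : ∀ i ∈ s, ∀ j ∈ s, i ≠ j → 6 ≤ ‖a i - a j‖ ^ 2) :
    ∑ i ∈ s, (1 - ‖a i‖ ^ 2 / 3) ≤ 1 := by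
  rcases s.eq_empty_or_nonempty with rfl | hs
  · simp
  have hm : (0 : ℝ) < s.card := by exact_mod_cast hs.card_pos
  set m : ℝ := (s.card : ℝ) with hmdef
  have h1 : ∑ i ∈ s, ∑ j ∈ s, ‖a i - a j‖ ^ 2
      = 2 * m * ∑ i ∈ s, ‖a i‖ ^ 2 - 2 * ‖∑ i ∈ s, a i‖ ^ 2 := by
    have h0 : ‖∑ i ∈ s, a i‖ ^ 2 = ∑ i ∈ s, ∑ j ∈ s, inner ℝ (a i) (a j) := by
      rw [← real_inner_self_eq_norm_sq, sum_inner]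
      simp [inner_sum]
    simp only [norm_sub_sq_real, Finset.sum_add_distrib, Finset.sum_sub_distrib, Finset.sum_const,
      nsmul_eq_mul, ← Finset.mul_sum, h0]
    ring
  have h2 : 6 * m * (m - 1) ≤ ∑ i ∈ s, ∑ j ∈ s, ‖a i - a j‖ ^ 2 := by
    have : ∀ i ∈ s, 6 * (m - 1) ≤ ∑ j ∈ s, ‖a i - a j‖ ^ 2 := by
      intro i hi
      have h3 : ∑ j ∈ s, (6 - if i = j then (6 : ℝ) else 0) ≤ ∑ j ∈ s, ‖a i - a j‖ ^ 2 := by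
        apply Finset.sum_le_sum
        intro j hj
        by_cases hij : i = j
        · simp [hij]
        · simpa [hij] using h i hi j hj hij
      rw [Finset.sum_sub_distrib, Finset.sum_ite_eq, if_pos hi] at h3
      simp only [Finset.sum_const, nsmul_eq_mul] at h3
      linarith
    have h4 := Finset.sum_le_sum this
    simp only [Finset.sum_const, nsmul_eq_mul] at h4
    linarith
  have h5 : 3 * (m - 1) ≤ ∑ i ∈ s, ‖a i‖ ^ 2 := by
    have : 0 ≤ ‖∑ i ∈ s, a i‖ ^ 2 := by positivity
    have : m * (3 * (m - 1)) ≤ m * ∑ i ∈ s, ‖a i‖ ^ 2 := by nlinarith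
    exact le_of_mul_le_mul_left this hm
  simp only [Finset.sum_sub_distrib, ← Finset.sum_div, Finset.sum_const, nsmul_eq_mul]
  linarith

open MeasureTheory in
lemma blich_pack_ennreal {E ι : Type*} [NormedAddCommGroup E] [InnerProductSpace ℝ E]
    (a : ι → E) (h : ∀ i j, i ≠ j → 6 ≤ ‖a i - a j‖ ^ 2) :
    ∑' i, ENNReal.ofReal (1 - ‖a i‖ ^ 2 / 3) ≤ 1 := by
  classical
  rw [ENNReal.tsum_eq_iSup_sum]
  refine iSup_le fun s => ?_
  rw [← Finset.sum_filter_of_ne (p := fun i => 0 < 1 - ‖a i‖ ^ 2 / 3)]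
  · rw [← ENNReal.ofReal_sum_of_nonneg]
    · rw [← ENNReal.ofReal_one]
      exact ENNReal.ofReal_le_ofReal (blich_pack _ _ fun i _ j _ hij => h i j hij)
    · intro i hi
      exact (Finset.mem_filter.1 hi).2.le
  · intro i _ hi
    simpa using hi

open MeasureTheory in
lemma blich_integral (n : ℕ) (hn : 0 < n) :
    ENNReal.ofReal (√3 ^ n / ((n : ℝ) / 2 + 1) * (√Real.pi ^ n / Real.Gamma ((n : ℝ) / 2 + 1))) ≤
    ∫⁻ y : EuclideanSpace ℝ (Fin n), ENNReal.ofReal (1 - ‖y‖ ^ 2 / 3) := by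
  have : Nonempty (Fin n) := ⟨⟨0, hn⟩⟩
  have e : ∀ y : EuclideanSpace ℝ (Fin n), ENNReal.ofReal (1 - ‖y‖ ^ 2 / 3) =
      ENNReal.ofReal (max (1 - ‖y‖ ^ 2 / 3) 0) := by
    intro y; simp
  simp_rw [e]
  rw [lintegral_eq_lintegral_meas_lt]
  rotate_left
  · exact Filter.Eventually.of_forall fun y => le_max_right _ _
  · fun_prop
  set C : ℝ := √Real.pi ^ n / Real.Gamma ((n : ℝ) / 2 + 1) with hC
  have hC0 : 0 ≤ C := by
    have : 0 < Real.Gamma ((n : ℝ) / 2 + 1) := Real.Gamma_pos_of_pos (by positivity)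
    positivity
  have hvol : ∀ t ∈ Set.Ioc (0 : ℝ) 1,
      volume {y : EuclideanSpace ℝ (Fin n) | t < max (1 - ‖y‖ ^ 2 / 3) 0} =
      ENNReal.ofReal (√3 ^ n * C * (1 - t) ^ ((n : ℝ) / 2)) := by
    intro t ht
    have : {y : EuclideanSpace ℝ (Fin n) | t < max (1 - ‖y‖ ^ 2 / 3) 0} =
        Metric.ball 0 (√3 * √(1 - t)) := by
      ext y
      simp only [Set.mem_ofPred_eq, lt_max_iff, mem_ball_zero_iff]
      rw [← Real.sqrt_mul (by norm_num), Real.lt_sqrt (norm_nonneg _)]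
      constructor
      · rintro (h | h)
        · linarith
        · exact absurd ht.1 (not_lt.2 h.le)
      · intro h; left; linarith
    rw [this, EuclideanSpace.volume_ball, Fintype.card_fin, ← hC, ← ENNReal.ofReal_pow (by positivity),
      ← ENNReal.ofReal_mul (by positivity)]
    congr 1
    have : (1 - t) ^ ((n : ℝ) / 2) = √(1 - t) ^ n := by
      rw [Real.sqrt_eq_rpow, ← Real.rpow_natCast, ← Real.rpow_mul (by linarith [ht.2])]
      congr 1; ring
    rw [this]; ring
  calc _ = ∫⁻ t in Set.Ioc (0 : ℝ) 1, ENNReal.ofReal (√3 ^ n * C * (1 - t) ^ ((n : ℝ) / 2)) := by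
        have hc : Continuous fun t : ℝ => √3 ^ n * C * (1 - t) ^ ((n : ℝ) / 2) :=
          continuous_const.mul ((continuous_const.sub continuous_id).rpow_const
            (fun _ => Or.inr (by positivity)))
        rw [← ofReal_integral_eq_lintegral_ofReal]
        · congr 1
          rw [← intervalIntegral.integral_of_le zero_le_one, intervalIntegral.integral_const_mul,
            intervalIntegral.integral_comp_sub_left (fun x => x ^ ((n : ℝ) / 2)) 1, integral_rpow]
          · have : (n : ℝ) / 2 + 1 ≠ 0 := by positivity
            simp [Real.zero_rpow this]
            ring
          · left; have : (0 : ℝ) ≤ (n : ℝ) / 2 := by positivity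
            linarith
        · exact (hc.integrableOn_Icc).mono_set Set.Ioc_subset_Icc_self
        · refine (ae_restrict_iff' measurableSet_Ioc).2 (Filter.Eventually.of_forall fun t ht => ?_)
          have : 0 ≤ 1 - t := by linarith [ht.2]
          simp only [Pi.zero_apply]; positivity
    _ = ∫⁻ t in Set.Ioc (0 : ℝ) 1,
          volume {y : EuclideanSpace ℝ (Fin n) | t < max (1 - ‖y‖ ^ 2 / 3) 0} :=
        setLIntegral_congr_fun measurableSet_Ioc fun t ht => (hvol t ht).symm
    _ ≤ _ := lintegral_mono_set Set.Ioc_subset_Ioi_self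

open MeasureTheory in
lemma blich_det (n : ℕ) (hn : 0 < n) (B : Matrix (Fin n) (Fin n) ℝ) (hB : B.det ≠ 0)
    (h : ∀ v : Fin n → ℤ, v ≠ 0 → 6 ≤ ∑ i, ((B *ᵥ (fun j => (v j : ℝ))) i) ^ 2) :
    √3 ^ n / ((n : ℝ) / 2 + 1) * (√Real.pi ^ n / Real.Gamma ((n : ℝ) / 2 + 1)) ≤ |B.det| := by
  let F : EuclideanSpace ℝ (Fin n) → ENNReal := fun y => ENNReal.ofReal (1 - ‖y‖ ^ 2 / 3)
  have hF : Measurable F := by fun_prop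
  let f : (Fin n → ℝ) → ENNReal := fun x => F (WithLp.toLp 2 (Matrix.toLin' B x))
  have hG : Measurable fun x : Fin n → ℝ => F (WithLp.toLp 2 x) :=
    hF.comp (PiLp.volume_preserving_toLp (Fin n)).measurable
  have h1 : ∫⁻ x, f x = ENNReal.ofReal |B.det⁻¹| * ∫⁻ y, F y := by
    rw [← (PiLp.volume_preserving_toLp (Fin n)).lintegral_comp hF]
    rw [← smul_eq_mul, ← lintegral_smul_measure, ← Real.map_matrix_volume_pi_eq_smul_volume_pi hB]
    rw [lintegral_map hG]
    exact (LinearMap.continuous_of_finiteDimensional _).measurable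
  let b := Pi.basisFun ℝ (Fin n)
  have h2 : ∫⁻ x, f x ≤ 1 := by
    have hv : volume (ZSpan.fundamentalDomain b) = 1 := by
      rw [ZSpan.fundamentalDomain_pi_basisFun, Real.volume_pi_Ico]; simp
    have : VAddInvariantMeasure (Submodule.span ℤ (Set.range b)) (Fin n → ℝ) volume :=
      inferInstanceAs <| VAddInvariantMeasure (Submodule.span ℤ (Set.range b)).toAddSubgroup
        (Fin n → ℝ) volume
    rw [(ZSpan.isAddFundamentalDomain b volume).lintegral_eq_tsum'' f]
    rw [← lintegral_tsum]
    · calc _ ≤ ∫⁻ x in ZSpan.fundamentalDomain b, 1 := by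
            apply lintegral_mono
            intro x
            apply blich_pack_ennreal
            intro g g' hg
            have hd : (g - g' : Fin n → ℝ) ∈ Submodule.span ℤ (Set.range b) :=
              Submodule.sub_mem _ g.2 g'.2
            rw [b.mem_span_iff_repr_mem ℤ] at hd
            choose w hw using hd
            have hw' : (fun j => (w j : ℝ)) = (g - g' : Fin n → ℝ) := by
              ext j; simpa [b] using hw j
            have hw0 : w ≠ 0 := by
              rintro rfl
              apply hg
              apply Subtype.ext
              rw [← sub_eq_zero, ← hw']
              ext j; simp
            have := h w hw0
            rw [hw'] at this
            rw [← WithLp.toLp_sub, ← map_sub, EuclideanSpace.real_norm_sq_eq]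
            have e : (g +ᵥ x) - (g' +ᵥ x) = (g - g' : Fin n → ℝ) := by
              simp [Submodule.vadd_def]
            rw [e]
            simpa [Matrix.toLin'_apply] using this
        _ = 1 := by simp [hv]
    · intro g
      refine Measurable.aemeasurable ?_
      refine (hG.comp (LinearMap.continuous_of_finiteDimensional (Matrix.toLin' B)).measurable).comp ?_
      exact measurable_const_vadd g
  rw [h1] at h2
  have h3 := blich_integral n hn
  have h4 := (mul_le_mul_right h3 (ENNReal.ofReal |B.det⁻¹|)).trans h2
  rw [← ENNReal.ofReal_mul (by positivity), ENNReal.ofReal_le_one, abs_inv, inv_mul_le_iff₀ (abs_pos.2 hB), mul_one] at h4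
  exact h4

lemma blich_num (n : ℕ) (hn2 : 2 ≤ n) (hn21 : n ≤ 21) (D : ℝ)
    (h : (3 * Real.pi) ^ n ≤ D * (((n : ℝ) / 2 + 1) * Real.Gamma ((n : ℝ) / 2 + 1)) ^ 2) :
    (3 * 2 ^ min n (24 - n) : ℝ) < D := by
  have hpi : (3.14 : ℝ) < Real.pi := Real.pi_gt_d2
  by_contra! hD
  have hG : (((n : ℝ) / 2 + 1) * Real.Gamma ((n : ℝ) / 2 + 1)) = Real.Gamma ((n : ℝ) / 2 + 1 + 1) :=
    (Real.Gamma_add_one (by positivity)).symm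
  rw [hG] at h
  have h' := h.trans (mul_le_mul_of_nonneg_right hD (sq_nonneg _))
  clear h hG hD
  rcases Nat.even_or_odd' n with ⟨k, hk | hk⟩
  · have e : (n : ℝ) / 2 + 1 + 1 = ((k + 1 : ℕ) : ℝ) + 1 := by rw [hk]; push_cast; ring
    rw [e, Real.Gamma_nat_eq_factorial] at h'
    have h1 : (3 * 3.14 : ℝ) ^ n ≤ (3 * Real.pi) ^ n := by gcongr
    have h2 := h1.trans h'
    have hk1 : 1 ≤ k := by omega
    have hk2 : k ≤ 10 := by omega
    clear h1 h' e
    subst hk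
    interval_cases k <;> norm_num [Nat.factorial] at h2
  · have e : (n : ℝ) / 2 + 1 + 1 = ((k + 1 : ℕ) : ℝ) + 1 + 1 / 2 := by rw [hk]; push_cast; ring
    rw [e, Real.Gamma_nat_add_one_add_half, div_pow, mul_pow (_ : ℝ) (√Real.pi), Real.sq_sqrt Real.pi_nonneg] at h'
    have h1 : 3 * (3 * 3.14 : ℝ) ^ (2 * k) * Real.pi ≤ (3 * Real.pi) ^ n := by
      rw [hk, pow_succ]
      have : (3 * 3.14 : ℝ) ^ (2 * k) ≤ (3 * Real.pi) ^ (2 * k) := by gcongr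
      nlinarith [Real.pi_pos]
    have h2 := h1.trans h'
    rw [mul_div_right_comm, ← mul_assoc] at h2
    have h3 := le_of_mul_le_mul_right h2 Real.pi_pos
    have hk1 : 1 ≤ k := by omega
    have hk2 : k ≤ 10 := by omega
    clear h1 h2 h' e
    subst hk
    interval_cases k <;> norm_num [Nat.doubleFactorial] at h3

lemma blich_psd {n : ℕ} (S : Matrix (Fin n) (Fin n) ℤ)
    (hneg : ∀ v : Fin n → ℤ, 0 ≤ v ⬝ᵥ (S *ᵥ v)) (x : Fin n → ℝ) :
    0 ≤ x ⬝ᵥ (S.map (Int.cast : ℤ → ℝ) *ᵥ x) := by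
  let q : (Fin n → ℝ) → ℝ := fun x => x ⬝ᵥ (S.map (Int.cast : ℤ → ℝ) *ᵥ x)
  have hq : Continuous q := by
    simp only [q, dotProduct, mulVec]; fun_prop
  have hlim : Filter.Tendsto (fun k : ℕ => fun i => (⌊x i * k⌋ : ℝ) / k) Filter.atTop (nhds x) := by
    rw [tendsto_pi_nhds]
    intro i
    have hl : Filter.Tendsto (fun k : ℕ => x i - 1 / (k : ℝ)) Filter.atTop (nhds (x i)) := by
      simpa using (tendsto_const_nhds (x := x i)).sub (tendsto_one_div_atTop_nhds_zero_nat (𝕜 := ℝ))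
    refine tendsto_of_tendsto_of_tendsto_of_le_of_le' hl tendsto_const_nhds ?_ ?_
    · filter_upwards [Filter.eventually_gt_atTop 0] with k hk
      have hk' : (0 : ℝ) < k := by exact_mod_cast hk
      rw [le_div_iff₀ hk', sub_mul, one_div_mul_cancel hk'.ne']
      exact (Int.sub_one_lt_floor _).le
    · filter_upwards [Filter.eventually_gt_atTop 0] with k hk
      have hk' : (0 : ℝ) < k := by exact_mod_cast hk
      rw [div_le_iff₀ hk']
      exact Int.floor_le _
  refine ge_of_tendsto ((hq.tendsto x).comp hlim) (Filter.Eventually.of_forall fun k => ?_)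
  let v : Fin n → ℤ := fun i => ⌊x i * k⌋
  have e : (fun i => (⌊x i * k⌋ : ℝ) / k) = (k : ℝ)⁻¹ • (fun i => (v i : ℝ)) := by
    ext i; simp [v, div_eq_inv_mul]
  have e2 : q (fun i => (v i : ℝ)) = ((v ⬝ᵥ (S *ᵥ v) : ℤ) : ℝ) := by
    simp [q, dotProduct, mulVec]
  have e3 : q ((k : ℝ)⁻¹ • (fun i => (v i : ℝ))) = (k : ℝ)⁻¹ * ((k : ℝ)⁻¹ * q (fun i => (v i : ℝ))) := by
    simp only [q, mulVec_smul, smul_dotProduct, dotProduct_smul, smul_eq_mul]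
  simp only [Function.comp]
  rw [e, e3, e2]
  have : (0 : ℝ) ≤ ((v ⬝ᵥ (S *ᵥ v) : ℤ) : ℝ) := by exact_mod_cast hneg v
  positivity

open scoped MatrixOrder in
lemma blich_factor {n : ℕ} (A : Matrix (Fin n) (Fin n) ℝ) (hA : A.PosSemidef) :
    ∃ B : Matrix (Fin n) (Fin n) ℝ, A = Bᵀ * B := by
  obtain ⟨B, hB⟩ := CStarAlgebra.nonneg_iff_eq_star_mul_self.mp hA.nonneg
  exact ⟨B, by rw [hB, star_eq_conjTranspose, conjTranspose_eq_transpose_of_trivial]⟩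

/-- An even negative definite lattice `T` of rank `n` with `2 ≤ n ≤ 21` containing no
vector of square `-2` and no vector of square `-4` satisfies
`|det T| > 3 · 2^(min(n, 24-n))`. -/
theorem stmt10 {n : ℕ} (hn2 : 2 ≤ n) (hn21 : n ≤ 21)
    (S : Matrix (Fin n) (Fin n) ℤ) (hsymm : S.IsSymm)
    (heven : ∀ v : Fin n → ℤ, Even (BM S v v))
    (hneg : ∀ v : Fin n → ℤ, v ≠ 0 → BM S v v < 0)
    (h2 : ∀ v : Fin n → ℤ, BM S v v ≠ -2)
    (h4 : ∀ v : Fin n → ℤ, BM S v v ≠ -4) :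
    3 * 2 ^ min n (24 - n) < S.det.natAbs := by
  have hmin : ∀ v : Fin n → ℤ, v ≠ 0 → 6 ≤ v ⬝ᵥ ((-S) *ᵥ v) := by
    intro v hv
    have a1 := heven v
    have a2 := hneg v hv
    have a3 := h2 v
    have a4 := h4 v
    have e : v ⬝ᵥ ((-S) *ᵥ v) = - BM S v v := by simp [BM, neg_mulVec]
    rw [e]
    obtain ⟨r, hr⟩ := a1
    omega
  have hdet : (-S).det ≠ 0 := by
    intro h0
    obtain ⟨v, hv, hv0⟩ := Matrix.exists_mulVec_eq_zero_iff.2 h0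
    have := hmin v hv
    rw [hv0] at this
    simp at this
  set A : Matrix (Fin n) (Fin n) ℝ := (-S).map (Int.cast : ℤ → ℝ) with hAdef
  have hAdet : A.det = ((-S).det : ℝ) := by
    rw [hAdef]; exact ((Int.castRingHom ℝ).map_det (-S)).symm
  have hA : A.PosSemidef := by
    refine Matrix.PosSemidef.of_dotProduct_mulVec_nonneg ?_ fun x => ?_
    · ext i j
      have := hsymm.apply i j
      simp [hAdef, this]
    · simp only [star_trivial]
      refine blich_psd _ (fun v => ?_) x
      by_cases hv : v = 0
      · simp [hv]
      · linarith [hmin v hv]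
  obtain ⟨B, hB⟩ := blich_factor A hA
  have hBdet : A.det = B.det ^ 2 := by rw [hB, det_mul, det_transpose, sq]
  have hB0 : B.det ≠ 0 := by
    intro h0
    rw [h0, hAdet] at hBdet
    apply hdet
    have : (((-S).det : ℤ) : ℝ) = 0 := by simpa using hBdet
    exact_mod_cast this
  have key := blich_det n (by omega) B hB0 (by
    intro v hv
    have h6 : (6 : ℝ) ≤ ((v ⬝ᵥ ((-S) *ᵥ v) : ℤ) : ℝ) := by exact_mod_cast hmin v hv
    have e : ((v ⬝ᵥ ((-S) *ᵥ v) : ℤ) : ℝ) = (fun j => (v j : ℝ)) ⬝ᵥ (A *ᵥ (fun j => (v j : ℝ))) := by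
      simp [hAdef, dotProduct, mulVec]
    rw [e, hB, ← mulVec_mulVec, dotProduct_mulVec, vecMul_transpose] at h6
    simpa [dotProduct, sq] using h6)
  have hG : 0 < Real.Gamma ((n : ℝ) / 2 + 1) := Real.Gamma_pos_of_pos (by positivity)
  have hnum := blich_num n hn2 hn21 (B.det ^ 2) (by
    rw [div_mul_div_comm, div_le_iff₀ (by positivity)] at key
    have k2 := pow_le_pow_left₀ (by positivity) key 2
    rw [mul_pow |B.det|, sq_abs] at k2
    refine le_of_eq_of_le ?_ k2
    rw [← mul_pow, ← pow_mul, mul_comm n 2, pow_mul, mul_pow √3 √Real.pi, Real.sq_sqrt (by norm_num),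
      Real.sq_sqrt Real.pi_nonneg])
  rw [← hBdet, hAdet] at hnum
  have hnum' : (3 * 2 ^ min n (24 - n) : ℤ) < (-S).det := by exact_mod_cast hnum
  have hab : (-S).det.natAbs = S.det.natAbs := by
    rw [det_neg, Int.natAbs_mul, Int.natAbs_pow]; simp
  rw [← hab]
  zify
  exact hnum'.trans_le (le_abs_self _)
end
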